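/- A lightcone framed curve (γ,ℓ⁺,ℓ⁻) : I → ℝ³₁ × Δ₄ with lightcone curvature (κ₁,κ₂,κ₃,α,β) is an (ℓ⁻,ℓ̄⁺)-Bertrand lightcone framed curve if and only if there exist smooth functions λ, k : I → ℝ with λ ≢ 0 such that k(t)α(t) = λ(t)κ₂(t) for all t ∈ I. -/

import Mathlib

open Matrix

noncomputable section

/-- The Minkowski pseudo-scalar product on `ℝ³`:
`⟨x,y⟩ = −x₁y₁ + x₂y₂ + x₃y₃`. -/
def mdot (x y : Fin 3 → ℝ) : ℝ := -(x 0 * y 0) + x 1 * y 1 + x 2 * y 2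

/-- The pseudo vector product `x ∧ y` on Minkowski `ℝ³`, i.e. the determinant of the
matrix with rows `(−e₁, e₂, e₃)`, `x`, `y`. -/
def mcross (x y : Fin 3 → ℝ) : Fin 3 → ℝ :=
  ![-(x 1 * y 2 - x 2 * y 1), x 2 * y 0 - x 0 * y 2, x 0 * y 1 - x 1 * y 0]

/-- The (punctured) lightcone `LC* = {x ≠ 0 : ⟨x,x⟩ = 0}`. -/
def LCstar (x : Fin 3 → ℝ) : Prop := x ≠ 0 ∧ mdot x x = 0

/-- Membership in `Δ₄ = {(v,w) ∈ LC* × LC* : ⟨v,w⟩ = −2}`. -/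
def MemDelta4 (v w : Fin 3 → ℝ) : Prop := LCstar v ∧ LCstar w ∧ mdot v w = -2

/-- `n(t) = −(1/2) ℓ⁺(t) ∧ ℓ⁻(t)`. -/
def lcn (lp lm : ℝ → Fin 3 → ℝ) : ℝ → Fin 3 → ℝ :=
  fun t => (-(1/2) : ℝ) • mcross (lp t) (lm t)

/-- Smoothness (on `I`) of a real valued function. -/
def Smooth1 (I : Set ℝ) (f : ℝ → ℝ) : Prop := ContDiffOn ℝ (⊤ : ℕ∞) f I

/-- Smoothness (on `I`) of an `ℝ³`-valued function. -/
def Smooth3 (I : Set ℝ) (f : ℝ → Fin 3 → ℝ) : Prop := ContDiffOn ℝ (⊤ : ℕ∞) f I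

/-- `λ ≢ 0` : the set where `λ` is non-zero is dense in `I`. -/
def NotIdentZero (I : Set ℝ) (f : ℝ → ℝ) : Prop :=
  I ⊆ closure {t | t ∈ I ∧ f t ≠ 0}

/-- A lightcone framed curve `(γ, ℓ⁺, ℓ⁻) : I → ℝ³₁ × Δ₄`. -/
structure IsLightconeFramedCurve (I : Set ℝ) (γ lp lm : ℝ → Fin 3 → ℝ) : Prop where
  smooth_base : Smooth3 I γ
  smooth_lp : Smooth3 I lp
  smooth_lm : Smooth3 I lm
  delta4 : ∀ t ∈ I, MemDelta4 (lp t) (lm t)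
  exists_coeffs : ∃ α β : ℝ → ℝ, Smooth1 I α ∧ Smooth1 I β ∧
    ∀ t ∈ I, deriv γ t = α t • lp t + β t • lm t

/-- `(κ₁, κ₂, κ₃, α, β)` is the lightcone curvature of the lightcone framed curve
`(γ, ℓ⁺, ℓ⁻)`. -/
structure HasLightconeCurvature (I : Set ℝ) (γ lp lm : ℝ → Fin 3 → ℝ)
    (κ₁ κ₂ κ₃ α β : ℝ → ℝ) : Prop where
  smooth_κ₁ : Smooth1 I κ₁
  smooth_κ₂ : Smooth1 I κ₂
  smooth_κ₃ : Smooth1 I κ₃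
  smooth_α : Smooth1 I α
  smooth_β : Smooth1 I β
  deriv_lp : ∀ t ∈ I, deriv lp t = κ₁ t • lp t + (2 * κ₃ t) • lcn lp lm t
  deriv_lm : ∀ t ∈ I, deriv lm t = (-κ₁ t) • lm t + (2 * κ₂ t) • lcn lp lm t
  deriv_n : ∀ t ∈ I, deriv (lcn lp lm) t = κ₂ t • lp t + κ₃ t • lm t
  deriv_base : ∀ t ∈ I, deriv γ t = α t • lp t + β t • lm t

/-- The vector field `ℓ⁺` built from a lightcone frame. -/
def fieldLp (lp lm : ℝ → Fin 3 → ℝ) : ℝ → Fin 3 → ℝ := fun t => lp t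
/-- The vector field `ℓ⁻` built from a lightcone frame. -/
def fieldLm (lp lm : ℝ → Fin 3 → ℝ) : ℝ → Fin 3 → ℝ := fun t => lm t
/-- `nᵀ = (ℓ⁺ + ℓ⁻)/2`. -/
def fieldNT (lp lm : ℝ → Fin 3 → ℝ) : ℝ → Fin 3 → ℝ := fun t => (1/2 : ℝ) • (lp t + lm t)
/-- `nˢ = (ℓ⁺ − ℓ⁻)/2`. -/
def fieldNS (lp lm : ℝ → Fin 3 → ℝ) : ℝ → Fin 3 → ℝ := fun t => (1/2 : ℝ) • (lp t - lm t)
/-- `n = −(1/2) ℓ⁺ ∧ ℓ⁻`. -/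
def fieldN (lp lm : ℝ → Fin 3 → ℝ) : ℝ → Fin 3 → ℝ := lcn lp lm
/-- `ℓ̃⁺ = nᵀ + n`. -/
def fieldLtp (lp lm : ℝ → Fin 3 → ℝ) : ℝ → Fin 3 → ℝ :=
  fun t => fieldNT lp lm t + fieldN lp lm t
/-- `ℓ̃⁻ = nᵀ − n`. -/
def fieldLtm (lp lm : ℝ → Fin 3 → ℝ) : ℝ → Fin 3 → ℝ :=
  fun t => fieldNT lp lm t - fieldN lp lm t

/-- `(γ,ℓ⁺,ℓ⁻)` and `(γ̄,ℓ̄⁺,ℓ̄⁻)` are `(v,w̄)`-mates. -/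
def AreMates (I : Set ℝ)
    (v w : (ℝ → Fin 3 → ℝ) → (ℝ → Fin 3 → ℝ) → ℝ → Fin 3 → ℝ)
    (γ lp lm γ' lp' lm' : ℝ → Fin 3 → ℝ) : Prop :=
  IsLightconeFramedCurve I γ lp lm ∧ IsLightconeFramedCurve I γ' lp' lm' ∧
  ∃ lam : ℝ → ℝ, Smooth1 I lam ∧ NotIdentZero I lam ∧
    (∀ t ∈ I, γ' t = γ t + lam t • v lp lm t) ∧
    (∀ t ∈ I, v lp lm t = w lp' lm' t)

/-- `(γ,ℓ⁺,ℓ⁻)` is a `(v,w̄)`-Bertrand lightcone framed curve. -/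
def IsBertrand (I : Set ℝ)
    (v w : (ℝ → Fin 3 → ℝ) → (ℝ → Fin 3 → ℝ) → ℝ → Fin 3 → ℝ)
    (γ lp lm : ℝ → Fin 3 → ℝ) : Prop :=
  ∃ γ' lp' lm' : ℝ → Fin 3 → ℝ, AreMates I v w γ lp lm γ' lp' lm'

theorem mdot_comm (x y : Fin 3 → ℝ) : mdot x y = mdot y x := by
  simp only [mdot]
  ring

theorem mdot_add_left (x y z : Fin 3 → ℝ) : mdot (x + y) z = mdot x z + mdot y z := by
  simp only [mdot, Pi.add_apply]
  ring

theorem mdot_smul_left (c : ℝ) (x z : Fin 3 → ℝ) : mdot (c • x) z = c * mdot x z := by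
  simp only [mdot, Pi.smul_apply, smul_eq_mul]
  ring

theorem mdot_add_right (x y z : Fin 3 → ℝ) : mdot x (y + z) = mdot x y + mdot x z := by
  rw [mdot_comm, mdot_add_left, mdot_comm y, mdot_comm z]

theorem mdot_smul_right (c : ℝ) (x z : Fin 3 → ℝ) : mdot x (c • z) = c * mdot x z := by
  rw [mdot_comm, mdot_smul_left, mdot_comm]

theorem mdot_mcross_left (x y : Fin 3 → ℝ) : mdot x (mcross x y) = 0 := by
  simp [mdot, mcross]
  ring

theorem mdot_mcross_right (x y : Fin 3 → ℝ) : mdot y (mcross x y) = 0 := by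
  simp [mdot, mcross]
  ring

theorem mdot_mcross_self (x y : Fin 3 → ℝ) :
    mdot (mcross x y) (mcross x y) = mdot x y ^ 2 - mdot x x * mdot y y := by
  simp [mdot, mcross]
  ring

theorem mdot_lp_lcn (lp lm : ℝ → Fin 3 → ℝ) (t : ℝ) : mdot (lp t) (lcn lp lm t) = 0 := by
  simp only [lcn, mdot_smul_right, mdot_mcross_left, mul_zero]

theorem mdot_lm_lcn (lp lm : ℝ → Fin 3 → ℝ) (t : ℝ) : mdot (lm t) (lcn lp lm t) = 0 := by
  simp only [lcn, mdot_smul_right, mdot_mcross_right, mul_zero]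

theorem mdot_lcn_self {lp lm : ℝ → Fin 3 → ℝ} {t : ℝ} (h : MemDelta4 (lp t) (lm t)) :
    mdot (lcn lp lm t) (lcn lp lm t) = 1 := by
  simp only [lcn, mdot_smul_left, mdot_smul_right, mdot_mcross_self, h.1.2, h.2.1.2, h.2.2]
  norm_num

theorem MemDelta4.symm {v w : Fin 3 → ℝ} (h : MemDelta4 v w) : MemDelta4 w v :=
  ⟨h.2.1, h.1, by rw [mdot_comm, h.2.2]⟩

/-- The null vector `ℓ⁺ + 2k n + k² ℓ⁻` completes `ℓ⁻` to a lightcone frame. -/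
theorem memDelta4_null_rotation {lp lm : ℝ → Fin 3 → ℝ} {t : ℝ} (h : MemDelta4 (lp t) (lm t))
    (k : ℝ) : MemDelta4 (lm t) (lp t + (2 * k) • lcn lp lm t + k ^ 2 • lm t) := by
  have hpair : mdot (lm t) (lp t + (2 * k) • lcn lp lm t + k ^ 2 • lm t) = -2 := by
    simp only [mdot_add_right, mdot_smul_right, mdot_lm_lcn, h.2.1.2, h.symm.2.2]
    ring
  refine ⟨h.2.1, ⟨fun h0 => ?_, ?_⟩, hpair⟩
  · rw [h0] at hpair
    simp [mdot] at hpair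
  · simp only [mdot_add_right, mdot_add_left, mdot_smul_right, mdot_smul_left, mdot_lm_lcn,
      mdot_lp_lcn, mdot_comm (lcn lp lm t) (lp t), mdot_comm (lcn lp lm t) (lm t), h.1.2,
      h.2.1.2, h.2.2, h.symm.2.2, mdot_lcn_self h]
    ring

theorem Smooth3.apply {I : Set ℝ} {f : ℝ → Fin 3 → ℝ} (hf : Smooth3 I f) (i : Fin 3) :
    Smooth1 I fun t => f t i :=
  contDiffOn_pi.1 hf i

theorem Smooth1.mdot {I : Set ℝ} {f g : ℝ → Fin 3 → ℝ} (hf : Smooth3 I f) (hg : Smooth3 I g) :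
    Smooth1 I fun t => mdot (f t) (g t) :=
  (((hf.apply 0).mul (hg.apply 0)).neg.add ((hf.apply 1).mul (hg.apply 1))).add
    ((hf.apply 2).mul (hg.apply 2))

theorem Smooth3.lcn {I : Set ℝ} {lp lm : ℝ → Fin 3 → ℝ} (hp : Smooth3 I lp)
    (hm : Smooth3 I lm) : Smooth3 I (lcn lp lm) := by
  have hminor (i j : Fin 3) : Smooth1 I fun t => lp t i * lm t j - lp t j * lm t i :=
    ((hp.apply i).mul (hm.apply j)).sub ((hp.apply j).mul (hm.apply i))
  refine ContDiffOn.const_smul _ (contDiffOn_pi.2 fun i => ?_)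
  fin_cases i
  · exact (hminor 1 2).neg
  · exact hminor 2 0
  · exact hminor 0 1

theorem deriv_base_add_smul_lm {I : Set ℝ} (hIo : IsOpen I)
    {γ lp lm γ' : ℝ → Fin 3 → ℝ} {κ₁ κ₂ κ₃ α β lam : ℝ → ℝ}
    (hF : IsLightconeFramedCurve I γ lp lm)
    (hC : HasLightconeCurvature I γ lp lm κ₁ κ₂ κ₃ α β)
    (hlam : Smooth1 I lam) (hγ' : ∀ t ∈ I, γ' t = γ t + lam t • lm t)
    {t : ℝ} (ht : t ∈ I) :
    deriv γ' t = α t • lp t + (β t + deriv lam t - lam t * κ₁ t) • lm t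
      + (2 * (lam t * κ₂ t)) • lcn lp lm t := by
  have hI : I ∈ nhds t := hIo.mem_nhds ht
  have hdγ : DifferentiableAt ℝ γ t := (hF.smooth_base.contDiffAt hI).differentiableAt (by simp)
  have hdlm : DifferentiableAt ℝ lm t := (hF.smooth_lm.contDiffAt hI).differentiableAt (by simp)
  have hdlam : DifferentiableAt ℝ lam t := (hlam.contDiffAt hI).differentiableAt (by simp)
  have heq : γ' =ᶠ[nhds t] fun s => γ s + lam s • lm s := by
    filter_upwards [hI] with s hs using hγ' s hs
  rw [heq.deriv_eq,
    (hdγ.hasDerivAt.fun_add (hdlam.hasDerivAt.fun_smul hdlm.hasDerivAt)).deriv,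
    hC.deriv_base t ht, hC.deriv_lm t ht]
  module

/-- `(ℓ⁻,ℓ̄⁺)`-Bertrand lightcone framed curves: existence condition. -/
theorem bertrand_lm_lpbar
    (I : Set ℝ) (hIo : IsOpen I) (hIc : I.OrdConnected)
    (γ lp lm : ℝ → Fin 3 → ℝ) (κ₁ κ₂ κ₃ α β : ℝ → ℝ)
    (hF : IsLightconeFramedCurve I γ lp lm)
    (hC : HasLightconeCurvature I γ lp lm κ₁ κ₂ κ₃ α β) :
    IsBertrand I fieldLm fieldLp γ lp lm ↔
      ∃ lam k : ℝ → ℝ, Smooth1 I lam ∧ Smooth1 I k ∧ NotIdentZero I lam ∧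
        ∀ t ∈ I, k t * α t = lam t * κ₂ t := by
  constructor
  · rintro ⟨γ', lp', lm', -, hF', lam, hlam, hlam0, hγ', hmate⟩
    obtain ⟨a, b, -, -, hab⟩ := hF'.exists_coeffs
    refine ⟨lam, fun t => (1 / 2) * mdot (lm' t) (lcn lp lm t), hlam,
      contDiffOn_const.mul (Smooth1.mdot hF'.smooth_lm (hF.smooth_lp.lcn hF.smooth_lm)),
      hlam0, fun t ht => ?_⟩
    have hd := hF.delta4 t ht
    have hm : lm t = lp' t := hmate t ht
    have hd' : MemDelta4 (lm t) (lm' t) := hm ▸ hF'.delta4 t ht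
    have hderiv := deriv_base_add_smul_lm hIo hF hC hlam hγ' ht
    rw [hab t ht, ← hm] at hderiv
    have h1 := congrArg (fun v => mdot v (lm t)) hderiv
    have h2 := congrArg (fun v => mdot v (lcn lp lm t)) hderiv
    simp only [mdot_add_left, mdot_smul_left, hd.2.1.2, hd.2.2, hd'.symm.2.2,
      mdot_comm (lcn lp lm t) (lm t), mdot_lm_lcn] at h1
    simp only [mdot_add_left, mdot_smul_left, mdot_lm_lcn, mdot_lp_lcn, mdot_lcn_self hd] at h2
    have hb : b t = α t := by linarith
    rw [hb] at h2
    linarith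
  · rintro ⟨lam, k, hlam, hk, hlam0, hrel⟩
    refine ⟨fun t => γ t + lam t • lm t, lm,
      fun t => lp t + (2 * k t) • lcn lp lm t + k t ^ 2 • lm t, hF, ?_,
      lam, hlam, hlam0, fun _ _ => rfl, fun _ _ => rfl⟩
    refine ⟨hF.smooth_base.add (hlam.smul hF.smooth_lm), hF.smooth_lm,
      (hF.smooth_lp.add ((contDiffOn_const.mul hk).smul (hF.smooth_lp.lcn hF.smooth_lm))).add
        ((hk.pow 2).smul hF.smooth_lm),
      fun t ht => memDelta4_null_rotation (hF.delta4 t ht) (k t),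
      fun t => β t + deriv lam t - lam t * κ₁ t - α t * k t ^ 2, α, ?_, hC.smooth_α,
      fun t ht => ?_⟩
    · exact ((hC.smooth_β.add (hlam.deriv_of_isOpen hIo le_rfl)).sub
        (hlam.mul hC.smooth_κ₁)).sub (hC.smooth_α.mul (hk.pow 2))
    · rw [deriv_base_add_smul_lm hIo hF hC hlam (fun _ _ => rfl) ht, ← hrel t ht]
      module
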